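/- For all d, e ≥ 1, the following cylinder-twist identity holds in End(V_n^{⊗(d+e)}), identifying V_n^{⊗(d+e)} = V_n^{⊗d} ⊗ V_n^{⊗e}: C_{d+e} = (C_d ⊗ Id_{V_n^{⊗e}}) ∘ Ř_{e,d} ∘ (C_e ⊗ Id_{V_n^{⊗d}}) ∘ Ř_{d,e} = Ř_{e,d} ∘ (C_e ⊗ Id_{V_n^{⊗d}}) ∘ Ř_{d,e} ∘ (C_d ⊗ Id_{V_n^{⊗e}}). -/

import Mathlib

noncomputable section
namespace QSP

variable {k : Type*} [Field k]

/-- Doubled value of a basis index: `val n j = 2*j - (n-1)`, so that the basis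
indices of `V_n` are the integers/half-integers `val/2` in `𝕀_n`. -/
def val (n : ℕ) (j : Fin n) : ℤ := 2 * (j : ℤ) - ((n : ℤ) - 1)

/-- Matrix of the operator `K_Q` on `V_n` in the standard basis. -/
def KQmat (Q : k) (n : ℕ) : Matrix (Fin n) (Fin n) k := fun c b =>
  if val n b = 0 then (if c = b then Q⁻¹ else 0)
  else (if c = Fin.rev b then 1 else 0) + (if val n b < 0 ∧ c = b then Q⁻¹ - Q else 0)

/-- Matrix of the operator `R_q` on `V_n ⊗ V_n` in the standard basis. -/
def Rmat (q : k) (n : ℕ) : Matrix (Fin n × Fin n) (Fin n × Fin n) k := fun c b =>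
  if b.1 = b.2 then (if c = b then q⁻¹ else 0)
  else if b.1 < b.2 then (if c = (b.2, b.1) then 1 else 0)
  else (if c = (b.2, b.1) then 1 else 0) + (if c = b then q⁻¹ - q else 0)

/-- The operators `T_i`, `0 ≤ i ≤ d-1`, on `V_n^{⊗ d}`; `T_0` acts as `K_Q` on the
first tensor factor, and `T_i` (for `i > 0`) acts as `R_q` on the `(i, i+1)`
tensor factors (1-based). -/
def TB (Q q : k) (n d : ℕ) (i : ℕ) : Module.End k ((Fin d → Fin n) → k) :=
  if _h0 : i = 0 then
    if hd : 0 < d then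
      Matrix.toLin' (fun c b =>
        if ∀ j, j ≠ (⟨0, hd⟩ : Fin d) → c j = b j then
          KQmat Q n (c ⟨0, hd⟩) (b ⟨0, hd⟩) else 0)
    else 0
  else if hi : i < d then
    Matrix.toLin' (fun c b =>
      if ∀ j, j ≠ (⟨i - 1, Nat.lt_of_le_of_lt (Nat.pred_le i) hi⟩ : Fin d) →
          j ≠ (⟨i, hi⟩ : Fin d) → c j = b j then
        Rmat q n (c ⟨i - 1, Nat.lt_of_le_of_lt (Nat.pred_le i) hi⟩, c ⟨i, hi⟩)
          (b ⟨i - 1, Nat.lt_of_le_of_lt (Nat.pred_le i) hi⟩, b ⟨i, hi⟩) else 0)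
  else 0

/-- The Jucys–Murphy elements `K_i = T_{i-1} ⋯ T_1 T_0 T_1 ⋯ T_{i-1}` acting on
`V_n^{⊗ d}`, for `1 ≤ i ≤ d` (junk value `1` for `i = 0`). -/
def JM (Q q : k) (n d : ℕ) : ℕ → Module.End k ((Fin d → Fin n) → k)
  | 0 => 1
  | 1 => TB Q q n d 0
  | i + 2 => TB Q q n d (i + 1) * JM Q q n d (i + 1) * TB Q q n d (i + 1)

/-- The element `c_K = K_1 K_2 ⋯ K_d` acting on `V_n^{⊗ d}`. -/
def cK (Q q : k) (n d : ℕ) : Module.End k ((Fin d → Fin n) → k) :=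
  ((List.range d).map (fun i => JM Q q n d (i + 1))).prod


/-- The extension `f ⊗ Id` of an operator `f` on `V_n^{⊗s}` to `V_n^{⊗m}`
(`s ≤ m`), acting on the first `s` tensor factors. -/
def extFirst (s m : ℕ) (h : s ≤ m) (n : ℕ) (f : Module.End k ((Fin s → Fin n) → k)) :
    Module.End k ((Fin m → Fin n) → k) :=
  Matrix.toLin' (fun c b =>
    if ∀ j : Fin m, s ≤ (j : ℕ) → c j = b j then
      (LinearMap.toMatrix' f) (fun j : Fin s => c (Fin.castLE h j))
        (fun j : Fin s => b (Fin.castLE h j))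
    else 0)

/-- The extension `Id ⊗ f` of an operator `f` on `V_n^{⊗s}` to `V_n^{⊗m}`
(`s ≤ m`), acting on the last `s` tensor factors. -/
def extLast (s m : ℕ) (h : s ≤ m) (n : ℕ) (f : Module.End k ((Fin s → Fin n) → k)) :
    Module.End k ((Fin m → Fin n) → k) :=
  Matrix.toLin' (fun c b =>
    if ∀ j : Fin m, (j : ℕ) < m - s → c j = b j then
      (LinearMap.toMatrix' f)
        (fun j : Fin s => c ⟨m - s + (j : ℕ), by have := j.isLt; omega⟩)
        (fun j : Fin s => b ⟨m - s + (j : ℕ), by have := j.isLt; omega⟩)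
    else 0)

/-- The operator `R_q` viewed as an endomorphism of `V_n ⊗ V_n = V_n^{⊗2}`. -/
def R2op (q : k) (n : ℕ) : Module.End k ((Fin 2 → Fin n) → k) :=
  Matrix.toLin' (fun c b => Rmat q n (c 0, c 1) (b 0, b 1))


section abstractPart

variable {M : Type*} [Monoid M]

/-- Jucys–Murphy elements in a monoid. -/
def aJ (T : ℕ → M) : ℕ → M
  | 0 => 1
  | 1 => T 0
  | i + 2 => T (i + 1) * aJ T (i + 1) * T (i + 1)

/-- `J_{d+1} ⋯ J_{d+e}`. -/
def aP (T : ℕ → M) (d : ℕ) : ℕ → M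
  | 0 => 1
  | e + 1 => aP T d e * aJ T (d + e + 1)

/-- `T_{o+1} ⋯ T_{o+a}`. -/
def aRow (T : ℕ → M) (o : ℕ) : ℕ → M
  | 0 => 1
  | a + 1 => aRow T o a * T (o + a + 1)

/-- `T_{o+a} ⋯ T_{o+1}`. -/
def aCol (T : ℕ → M) (o : ℕ) : ℕ → M
  | 0 => 1
  | a + 1 => T (o + a + 1) * aCol T o a

/-- `Ř_{e,d}`. -/
def aX (T : ℕ → M) (e : ℕ) : ℕ → M
  | 0 => 1
  | d + 1 => aRow T d e * aX T e d

/-- `Ř_{d,e}`. -/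
def aY (T : ℕ → M) (e : ℕ) : ℕ → M
  | 0 => 1
  | d + 1 => aY T e d * aCol T d e

/-- type B braid relations -/
structure IsBraidB (T : ℕ → M) : Prop where
  far : ∀ i j, i + 2 ≤ j → Commute (T i) (T j)
  br : ∀ i, 1 ≤ i → T i * T (i + 1) * T i = T (i + 1) * T i * T (i + 1)
  bb : T 0 * T 1 * T 0 * T 1 = T 1 * T 0 * T 1 * T 0

variable {T : ℕ → M}

lemma aJ_far (h : IsBraidB T) : ∀ j i, j < i → 1 ≤ j → Commute (T i) (aJ T j)
  | 0, i, hi, hj => by omega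
  | 1, i, hi, hj => (h.far 0 i (by omega)).symm
  | j + 2, i, hi, hj => by
    have h1 := (h.far (j + 1) i (by omega)).symm
    exact (h1.mul_right (aJ_far h (j + 1) i (by omega) (by omega))).mul_right h1

lemma aJ_comm (h : IsBraidB T) (i : ℕ) (hi : 1 ≤ i) : ∀ t, Commute (T i) (aJ T (i + 2 + t))
  | 0 => by
    obtain ⟨i, rfl⟩ : ∃ j, i = j + 1 := ⟨i - 1, by omega⟩
    have h1 := h.br (i + 1) hi
    have h2 := aJ_far h (i + 1) (i + 2) (by omega) (by omega)
    change T (i+1) * (T (i+2) * (T (i+1) * aJ T (i+1) * T (i+1)) * T (i+2)) =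
      (T (i+2) * (T (i+1) * aJ T (i+1) * T (i+1)) * T (i+2)) * T (i+1)
    have h2' : T (i+2) * aJ T (i+1) = aJ T (i+1) * T (i+2) := h2
    simp only [Nat.add_assoc, Nat.reduceAdd] at h1
    calc _ = (T (i+1) * T (i+2) * T (i+1)) * aJ T (i+1) * T (i+1) * T (i+2) := by
          simp only [mul_assoc]
      _ = T (i+2) * T (i+1) * (T (i+2) * aJ T (i+1)) * T (i+1) * T (i+2) := by
          rw [h1]; simp only [mul_assoc]
      _ = T (i+2) * T (i+1) * aJ T (i+1) * (T (i+2) * T (i+1) * T (i+2)) := by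
          rw [h2']; simp only [mul_assoc]
      _ = _ := by rw [← h1]; simp only [mul_assoc]
  | t + 1 => by
    have h1 := h.far i (i + 2 + t) (by omega)
    have h2 := aJ_comm h i hi t
    have : aJ T (i + 2 + (t + 1)) = T (i + 2 + t) * aJ T (i + 2 + t) * T (i + 2 + t) := by
      have e1 : i + 2 + (t + 1) = (i + 1 + t) + 2 := by omega
      have e2 : i + 2 + t = (i + 1 + t) + 1 := by omega
      rw [e1, e2]; rfl
    rw [this]
    exact (h1.mul_right h2).mul_right h1

lemma aJ_comm0 (h : IsBraidB T) : ∀ j, Commute (T 0) (aJ T j)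
  | 0 => Commute.one_right _
  | 1 => Commute.refl _
  | 2 => by
    have := h.bb
    change T 0 * (T 1 * T 0 * T 1) = (T 1 * T 0 * T 1) * T 0
    simpa only [mul_assoc] using this
  | j + 3 => by
    have h1 := h.far 0 (j + 2) (by omega)
    exact (h1.mul_right (aJ_comm0 h (j + 2))).mul_right h1

lemma aJ_commJ (h : IsBraidB T) : ∀ i j, i < j → Commute (aJ T i) (aJ T j)
  | 0, j, _ => Commute.one_left _
  | 1, j, _ => aJ_comm0 h j
  | i + 2, j, hij => by
    have h1 : Commute (T (i + 1)) (aJ T j) := by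
      have := aJ_comm h (i + 1) (by omega) (j - (i + 3))
      rwa [show i + 1 + 2 + (j - (i + 3)) = j by omega] at this
    exact (h1.mul_left (aJ_commJ h (i + 1) j (by omega))).mul_left h1

lemma aP_comm (h : IsBraidB T) (d : ℕ) : ∀ e, Commute (aP T 0 d) (aP T d e)
  | 0 => Commute.one_right _
  | e + 1 => by
    refine (aP_comm h d e).mul_right ?_
    have : ∀ c, c ≤ d → Commute (aP T 0 c) (aJ T (d + e + 1)) := by
      intro c
      induction c with
      | zero => intro _; exact Commute.one_left _
      | succ c ih => intro hc; exact (ih (by omega)).mul_left (aJ_commJ h _ _ (by omega))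
    exact this d le_rfl

lemma aP_add (d : ℕ) : ∀ e, aP T 0 (d + e) = aP T 0 d * aP T d e
  | 0 => by simp [aP]
  | e + 1 => by
    change aP T 0 (d + e) * aJ T (0 + (d + e) + 1) = aP T 0 d * (aP T d e * aJ T (d + e + 1))
    rw [aP_add d e, mul_assoc, Nat.zero_add]

lemma aP_shift (h : IsBraidB T) (d : ℕ) : ∀ e, aRow T d e * aP T d e * aCol T d e = aP T (d + 1) e
  | 0 => by simp [aP, aRow, aCol]
  | e + 1 => by
    have h1 : Commute (T (d + e + 1)) (aP T d e) := by
      have : ∀ c, c ≤ e → Commute (T (d + e + 1)) (aP T d c) := by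
        intro c
        induction c with
        | zero => intro _; exact Commute.one_right _
        | succ c ih =>
          intro hc
          exact (ih (by omega)).mul_right (aJ_far h _ _ (by omega) (by omega))
      exact this e le_rfl
    have h2 : Commute (aCol T d e) (aJ T (d + e + 2)) := by
      have : ∀ c, c ≤ e → Commute (aCol T d c) (aJ T (d + e + 2)) := by
        intro c
        induction c with
        | zero => intro _; exact Commute.one_left _
        | succ c ih =>
          intro hc
          refine Commute.mul_left ?_ (ih (by omega))
          have := aJ_comm h (d + c + 1) (by omega) (e - (c + 1))
          rwa [show d + c + 1 + 2 + (e - (c + 1)) = d + e + 2 by omega] at this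
      exact this e le_rfl
    have h3 : aJ T (d + e + 2) = T (d + e + 1) * aJ T (d + e + 1) * T (d + e + 1) := rfl
    change (aRow T d e * T (d + e + 1)) * (aP T d e * aJ T (d + e + 1)) *
      (T (d + e + 1) * aCol T d e) = aP T (d + 1) e * aJ T (d + 1 + e + 1)
    rw [← aP_shift h d e, show d + 1 + e + 1 = d + e + 2 by omega]
    calc _ = aRow T d e * (T (d + e + 1) * aP T d e) * aJ T (d + e + 1) * T (d + e + 1) *
              aCol T d e := by simp only [mul_assoc]
      _ = aRow T d e * aP T d e * (aJ T (d + e + 2) * aCol T d e) := by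
          rw [h1.eq, h3]; simp only [mul_assoc]
      _ = _ := by rw [← h2.eq]; simp only [mul_assoc]

lemma aX_aY (h : IsBraidB T) (e : ℕ) : ∀ d, aX T e d * aP T 0 e * aY T e d = aP T d e
  | 0 => by simp [aX, aY]
  | d + 1 => by
    rw [← aP_shift h d e, ← aX_aY h e d]
    simp only [aX, aY, mul_assoc]

end abstractPart

section extPart

/-- Extension of an operator along an injection of tensor positions. -/
def ext {s m n : ℕ} (ι : Fin s → Fin m) (f : Module.End k ((Fin s → Fin n) → k)) :
    Module.End k ((Fin m → Fin n) → k) where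
  toFun v c := f (fun a => v (Function.extend ι a c)) (fun j => c (ι j))
  map_add' v w := by
    funext c
    exact congrFun (f.map_add (fun a => v (Function.extend ι a c))
      (fun a => w (Function.extend ι a c))) _
  map_smul' r v := by
    funext c
    exact congrFun (f.map_smul r (fun a => v (Function.extend ι a c))) _

lemma ext_apply {s m n : ℕ} (ι : Fin s → Fin m) (f : Module.End k ((Fin s → Fin n) → k)) (v c) :
    ext ι f v c = f (fun a => v (Function.extend ι a c)) (fun j => c (ι j)) := rfl

lemma extend_self {s m n : ℕ} {ι : Fin s → Fin m} (hι : Function.Injective ι) (c : Fin m → Fin n) :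
    Function.extend ι (fun j => c (ι j)) c = c := by
  funext j
  by_cases h : ∃ i, ι i = j
  · obtain ⟨i, rfl⟩ := h; rw [hι.extend_apply]
  · rw [Function.extend_apply' _ _ _ h]

lemma extend_extend {s m n : ℕ} {ι : Fin s → Fin m} (hι : Function.Injective ι)
    (a a' : Fin s → Fin n) (c : Fin m → Fin n) :
    Function.extend ι a (Function.extend ι a' c) = Function.extend ι a c := by
  funext j
  by_cases h : ∃ i, ι i = j
  · obtain ⟨i, rfl⟩ := h; rw [hι.extend_apply, hι.extend_apply]
  · rw [Function.extend_apply' _ _ _ h, Function.extend_apply' _ _ _ h,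
      Function.extend_apply' _ _ _ h]

lemma ext_mul {s m n : ℕ} {ι : Fin s → Fin m} (hι : Function.Injective ι)
    (f g : Module.End k ((Fin s → Fin n) → k)) : ext ι (f * g) = ext ι f * ext ι g := by
  apply LinearMap.ext; intro v; funext c
  simp only [Module.End.mul_apply, ext_apply, extend_extend hι, hι.extend_apply]

lemma ext_one {s m n : ℕ} {ι : Fin s → Fin m} (hι : Function.Injective ι) :
    ext ι (1 : Module.End k ((Fin s → Fin n) → k)) = 1 := by
  apply LinearMap.ext; intro v; funext c
  simp only [Module.End.one_apply, ext_apply, extend_self hι]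

lemma ext_ext {r s m n : ℕ} {ι : Fin s → Fin m} (hι : Function.Injective ι) {κ : Fin r → Fin s}
    (hκ : Function.Injective κ) (f : Module.End k ((Fin r → Fin n) → k)) :
    ext ι (ext κ f) = ext (ι ∘ κ) f := by
  apply LinearMap.ext; intro v; funext c
  simp only [ext_apply, Function.comp]
  refine congrFun (congrArg f ?_) _
  funext a
  refine congrArg v ?_
  funext j
  by_cases h : ∃ i, ι i = j
  · obtain ⟨i, rfl⟩ := h
    rw [hι.extend_apply]
    by_cases h' : ∃ l, κ l = i
    · obtain ⟨l, rfl⟩ := h'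
      rw [hκ.extend_apply]
      exact ((hι.comp hκ).extend_apply a c l).symm
    · rw [Function.extend_apply' _ _ _ h', Function.extend_apply']
      rintro ⟨l, hl⟩
      exact h' ⟨l, hι hl⟩
  · rw [Function.extend_apply' _ _ _ h, Function.extend_apply']
    rintro ⟨l, hl⟩
    exact h ⟨_, hl⟩

lemma toLin_eq_ext {s m n : ℕ} {ι : Fin s → Fin m} (hι : Function.Injective ι)
    (F : Matrix (Fin s → Fin n) (Fin s → Fin n) k)
    (G : Matrix (Fin m → Fin n) (Fin m → Fin n) k)
    (h1 : ∀ c b, (∀ j, (¬ ∃ i, ι i = j) → c j = b j) →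
      G c b = F (fun j => c (ι j)) (fun j => b (ι j)))
    (h2 : ∀ c b, (¬ ∀ j, (¬ ∃ i, ι i = j) → c j = b j) → G c b = 0) :
    Matrix.toLin' G = ext ι (Matrix.toLin' F) := by
  classical
  apply LinearMap.ext; intro v; funext c
  rw [ext_apply, Matrix.toLin'_apply, Matrix.toLin'_apply]
  simp only [Matrix.mulVec, dotProduct]
  symm
  have hinj : Function.Injective (fun a : Fin s → Fin n => Function.extend ι a c) := by
    intro a a' h
    funext i
    have := congrFun h (ι i)
    simpa only [hι.extend_apply] using this
  refine Finset.sum_of_injOn (fun a => Function.extend ι a c) hinj.injOn (by simp) ?_ ?_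
  · intro b _ hb
    rw [h2, zero_mul]
    intro hcb
    apply hb
    refine ⟨fun j => b (ι j), by simp, ?_⟩
    funext j
    by_cases h : ∃ i, ι i = j
    · obtain ⟨i, rfl⟩ := h; simp only [hι.extend_apply]
    · simp only [Function.extend_apply' _ _ _ h]; exact hcb j h
  · intro a _
    rw [h1]
    · simp only [hι.extend_apply]
    · intro j hj
      rw [Function.extend_apply' _ _ _ hj]

lemma extFirst_eq {s m : ℕ} (h : s ≤ m) (n : ℕ) (f : Module.End k ((Fin s → Fin n) → k)) :
    extFirst s m h n f = ext (Fin.castLE h) f := by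
  have hr : ∀ j : Fin m, (¬ ∃ i, Fin.castLE h i = j) ↔ s ≤ (j : ℕ) := by
    intro j
    constructor
    · intro h'
      by_contra hlt
      exact h' ⟨⟨j, by omega⟩, rfl⟩
    · rintro h' ⟨i, rfl⟩
      have := i.isLt
      simp at h'
      omega
  conv_rhs => rw [← Matrix.toLin'_toMatrix' f]
  unfold extFirst
  apply toLin_eq_ext (Fin.castLE_injective h)
  · intro c b hcb
    simp only [hr] at hcb
    rw [if_pos hcb]
  · intro c b hcb
    simp only [hr] at hcb
    rw [if_neg hcb]

/-- last positions -/
def lastI {s m : ℕ} (h : s ≤ m) (j : Fin s) : Fin m := ⟨m - s + j, by have := j.isLt; omega⟩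

lemma lastI_inj {s m : ℕ} (h : s ≤ m) : Function.Injective (lastI h) := by
  intro a b hab
  simp only [lastI, Fin.mk.injEq] at hab
  exact Fin.ext (by omega)

lemma extLast_eq {s m : ℕ} (h : s ≤ m) (n : ℕ) (f : Module.End k ((Fin s → Fin n) → k)) :
    extLast s m h n f = ext (lastI h) f := by
  have hr : ∀ j : Fin m, (¬ ∃ i, lastI h i = j) ↔ (j : ℕ) < m - s := by
    intro j
    constructor
    · intro h'
      by_contra hlt
      exact h' ⟨⟨j - (m - s), by omega⟩, Fin.ext (by simp [lastI]; omega)⟩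
    · rintro h' ⟨i, rfl⟩
      simp [lastI] at h'
  conv_rhs => rw [← Matrix.toLin'_toMatrix' f]
  unfold extLast
  apply toLin_eq_ext (lastI_inj h)
  · intro c b hcb
    simp only [hr] at hcb
    rw [if_pos hcb]
    rfl
  · intro c b hcb
    simp only [hr] at hcb
    rw [if_neg hcb]

/-- one-factor operator -/
def K1op (Q : k) (n : ℕ) : Module.End k ((Fin 1 → Fin n) → k) :=
  Matrix.toLin' (fun c b => KQmat Q n (c 0) (b 0))

lemma TB_zero (Q q : k) (n m : ℕ) (hm : 0 < m) :
    TB Q q n m 0 = ext (fun _ : Fin 1 => (⟨0, hm⟩ : Fin m)) (K1op Q n) := by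
  unfold TB K1op
  rw [dif_pos rfl, dif_pos hm]
  have hr : ∀ j : Fin m, (¬ ∃ _i : Fin 1, (⟨0, hm⟩ : Fin m) = j) ↔ j ≠ ⟨0, hm⟩ := by
    intro j
    simp [eq_comm]
  apply toLin_eq_ext (fun a b _ => Subsingleton.elim a b)
  · intro c b hcb
    simp only [hr] at hcb
    rw [if_pos hcb]
  · intro c b hcb
    simp only [hr] at hcb
    rw [if_neg hcb]

/-- two adjacent positions -/
def pairI {m : ℕ} (i : ℕ) (hi : i + 1 < m) (j : Fin 2) : Fin m := ⟨i + j, by omega⟩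

lemma pairI_inj {m : ℕ} (i : ℕ) (hi : i + 1 < m) : Function.Injective (pairI i hi) := by
  intro a b hab
  simp only [pairI, Fin.mk.injEq] at hab
  exact Fin.ext (by omega)

lemma TB_succ (Q q : k) (n m i : ℕ) (hi : i + 1 < m) :
    TB Q q n m (i + 1) = ext (pairI i hi) (R2op q n) := by
  unfold TB R2op
  rw [dif_neg (by omega), dif_pos hi]
  have hr : ∀ j : Fin m, (¬ ∃ l, pairI i hi l = j) ↔
      (j ≠ ⟨i + 1 - 1, by omega⟩ ∧ j ≠ ⟨i + 1, hi⟩) := by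
    intro j
    simp [Fin.exists_fin_two, pairI, eq_comm]
  apply toLin_eq_ext (pairI_inj i hi)
  · intro c b hcb
    simp only [hr, and_imp] at hcb
    rw [if_pos hcb]
    rfl
  · intro c b hcb
    simp only [hr, and_imp] at hcb
    rw [if_neg hcb]

lemma TB_big (Q q : k) (n m i : ℕ) (hi : m ≤ i) : TB Q q n m i = 0 := by
  unfold TB
  split_ifs <;> first | rfl | omega

lemma ext_TB_zero (Q q : k) (n s m : ℕ) (hs : 0 < s) (hm : 0 < m) (ι : Fin s → Fin m)
    (hι : Function.Injective ι) (h : ι ⟨0, hs⟩ = ⟨0, hm⟩) :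
    ext ι (TB Q q n s 0) = TB Q q n m 0 := by
  rw [TB_zero _ _ _ _ hs, TB_zero _ _ _ _ hm, ext_ext hι (fun a b _ => Subsingleton.elim a b)]
  congr 1
  funext _
  exact h

lemma ext_TB_succ (Q q : k) (n s m i j : ℕ) (hs : i + 1 < s) (hm : j + 1 < m) (ι : Fin s → Fin m)
    (hι : Function.Injective ι) (h : (ι ⟨i, by omega⟩ : ℕ) = j)
    (h' : (ι ⟨i + 1, hs⟩ : ℕ) = j + 1) :
    ext ι (TB Q q n s (i + 1)) = TB Q q n m (j + 1) := by
  rw [TB_succ _ _ _ _ _ hs, TB_succ _ _ _ _ _ hm, ext_ext hι (pairI_inj _ _)]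
  congr 1
  funext l
  fin_cases l
  · exact Fin.ext h
  · exact Fin.ext h'

lemma castLE_TB (Q q : k) (n s m i : ℕ) (h : s ≤ m) (hi : i < s) :
    ext (Fin.castLE h) (TB Q q n s i) = TB Q q n m i := by
  cases i with
  | zero => exact ext_TB_zero _ _ _ _ _ hi (by omega) _ (Fin.castLE_injective h) rfl
  | succ i => exact ext_TB_succ _ _ _ _ _ _ _ hi (by omega) _ (Fin.castLE_injective h) rfl rfl

lemma lastI_TB (Q q : k) (n s m i : ℕ) (h : s ≤ m) (hi : i + 1 < s) :
    ext (lastI h) (TB Q q n s (i + 1)) = TB Q q n m (m - s + i + 1) :=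
  ext_TB_succ _ _ _ _ _ _ _ hi (by omega) _ (lastI_inj h) rfl rfl

end extPart

section braidPart

/-- diagonal coefficient of R -/
def al (q : k) (n : ℕ) (x y : Fin n) : k :=
  if val n x = val n y then q⁻¹ else if val n x < val n y then 0 else q⁻¹ - q
/-- off-diagonal coefficient of R -/
def be (k : Type*) [Field k] (n : ℕ) (x y : Fin n) : k := if val n x = val n y then 0 else 1
/-- diagonal coefficient of K -/
def al0 (Q : k) (n : ℕ) (x : Fin n) : k :=
  if val n x = 0 then Q⁻¹ else if val n x < 0 then Q⁻¹ - Q else 0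
/-- off-diagonal coefficient of K -/
def be0 (k : Type*) [Field k] (n : ℕ) (x : Fin n) : k := if val n x = 0 then 0 else 1

lemma val_inj {n : ℕ} {x y : Fin n} : val n x = val n y ↔ x = y := by
  unfold val
  constructor
  · intro h; exact Fin.ext (by omega)
  · rintro rfl; rfl

lemma val_lt {n : ℕ} {x y : Fin n} : val n x < val n y ↔ x < y := by
  unfold val
  rw [Fin.lt_def]; omega

lemma val_rev {n : ℕ} (x : Fin n) : val n (Fin.rev x) = - val n x := by
  unfold val
  rw [Fin.val_rev]; omega

lemma Rmat_eq (q : k) (n : ℕ) (c1 c2 x y : Fin n) :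
    Rmat q n (c1, c2) (x, y) = (if c1 = x ∧ c2 = y then al q n x y else 0) +
      (if c1 = y ∧ c2 = x then be k n x y else 0) := by
  unfold Rmat al be
  simp only [val_inj, val_lt, Prod.mk.injEq]
  rcases lt_trichotomy x y with h | h | h
  · simp [h, h.ne]
  · subst h; simp
  · simp [h.not_gt, h.ne', add_comm]

lemma KQmat_eq (Q : k) (n : ℕ) (c x : Fin n) :
    KQmat Q n c x = (if c = x then al0 Q n x else 0) + (if c = Fin.rev x then be0 k n x else 0) := by
  unfold KQmat al0 be0
  rcases lt_trichotomy (val n x) 0 with h | h | h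
  · simp [h, h.ne, add_comm]
  · simp [h]
  · simp [h.not_gt, h.ne']

lemma toLin_single {ι : Type*} [Fintype ι] [DecidableEq ι] (G : Matrix ι ι k) (b c : ι) :
    Matrix.toLin' G (Pi.single b 1) c = G c b := by
  rw [Matrix.toLin'_apply, Matrix.mulVec_single_one, Matrix.col_apply]

/-- basis vector -/
abbrev bv {n m : ℕ} (b : Fin m → Fin n) : (Fin m → Fin n) → k := Pi.single b 1

lemma TB_zero_bv (Q q : k) (n m : ℕ) (hm : 0 < m) (b b' : Fin m → Fin n)
    (h0 : b' ⟨0, hm⟩ = Fin.rev (b ⟨0, hm⟩)) (h : ∀ j, j ≠ ⟨0, hm⟩ → b' j = b j) :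
    TB Q q n m 0 (bv b) = al0 Q n (b ⟨0, hm⟩) • bv b + be0 k n (b ⟨0, hm⟩) • bv b' := by
  funext c
  unfold TB
  rw [dif_pos rfl, dif_pos hm]
  refine (toLin_single _ b c).trans ?_
  simp only [KQmat_eq, bv, Pi.add_apply,
    Pi.smul_apply, Pi.single_apply, smul_eq_mul, mul_ite, mul_one, mul_zero]
  have e1 : c = b ↔ (∀ j, j ≠ ⟨0, hm⟩ → c j = b j) ∧ c ⟨0, hm⟩ = b ⟨0, hm⟩ := by
    constructor
    · rintro rfl; simp
    · rintro ⟨h1, h2⟩; funext j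
      by_cases hj : j = ⟨0, hm⟩
      · rw [hj, h2]
      · exact h1 j hj
  have e2 : c = b' ↔ (∀ j, j ≠ ⟨0, hm⟩ → c j = b j) ∧ c ⟨0, hm⟩ = Fin.rev (b ⟨0, hm⟩) := by
    constructor
    · rintro rfl; exact ⟨h, h0⟩
    · rintro ⟨h1, h2⟩; funext j
      by_cases hj : j = ⟨0, hm⟩
      · rw [hj, h2, h0]
      · rw [h1 j hj, h j hj]
  simp only [e1, e2]
  by_cases hc : ∀ j, j ≠ ⟨0, hm⟩ → c j = b j
  · simp only [if_pos hc, and_iff_right hc]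
  · simp [hc]

lemma TB_succ_bv (Q q : k) (n m i : ℕ) (hi : i + 1 < m) (b b' : Fin m → Fin n)
    (h0 : b' ⟨i, by omega⟩ = b ⟨i + 1, hi⟩) (h0' : b' ⟨i + 1, hi⟩ = b ⟨i, by omega⟩)
    (h : ∀ j, j ≠ ⟨i, by omega⟩ → j ≠ ⟨i + 1, hi⟩ → b' j = b j) :
    TB Q q n m (i + 1) (bv b) = al q n (b ⟨i, by omega⟩) (b ⟨i + 1, hi⟩) • bv b +
      be k n (b ⟨i, by omega⟩) (b ⟨i + 1, hi⟩) • bv b' := by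
  funext c
  unfold TB
  rw [dif_neg (by omega), dif_pos hi]
  refine (toLin_single _ b c).trans ?_
  simp only [Rmat_eq, bv, Pi.add_apply,
    Pi.smul_apply, Pi.single_apply, smul_eq_mul, mul_ite, mul_one, mul_zero, Nat.add_sub_cancel]
  have e1 : c = b ↔ (∀ j, j ≠ ⟨i, by omega⟩ → j ≠ ⟨i + 1, hi⟩ → c j = b j) ∧
      c ⟨i, by omega⟩ = b ⟨i, by omega⟩ ∧ c ⟨i + 1, hi⟩ = b ⟨i + 1, hi⟩ := by
    constructor
    · rintro rfl; simp
    · rintro ⟨h1, h2, h3⟩; funext j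
      by_cases hj : j = ⟨i, by omega⟩
      · rw [hj, h2]
      · by_cases hj' : j = ⟨i + 1, hi⟩
        · rw [hj', h3]
        · exact h1 j hj hj'
  have e2 : c = b' ↔ (∀ j, j ≠ ⟨i, by omega⟩ → j ≠ ⟨i + 1, hi⟩ → c j = b j) ∧
      c ⟨i, by omega⟩ = b ⟨i + 1, hi⟩ ∧ c ⟨i + 1, hi⟩ = b ⟨i, by omega⟩ := by
    constructor
    · rintro rfl; exact ⟨h, h0, h0'⟩
    · rintro ⟨h1, h2, h3⟩; funext j
      by_cases hj : j = ⟨i, by omega⟩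
      · rw [hj, h2, h0]
      · by_cases hj' : j = ⟨i + 1, hi⟩
        · rw [hj', h3, h0']
        · rw [h1 j hj hj', h j hj hj']
  simp only [e1, e2]
  by_cases hc : ∀ j, j ≠ ⟨i, by omega⟩ → j ≠ ⟨i + 1, hi⟩ → c j = b j
  · simp only [if_pos hc, and_iff_right hc]
  · simp [hc]

lemma TB_zero_bv' (Q q : k) (n m : ℕ) (hm : 0 < m) (x : Fin n) (b b' : Fin m → Fin n)
    (hx : b ⟨0, hm⟩ = x)
    (h0 : b' ⟨0, hm⟩ = Fin.rev x) (h : ∀ j, j ≠ ⟨0, hm⟩ → b' j = b j) :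
    TB Q q n m 0 (bv b) = al0 Q n x • bv b + be0 k n x • bv b' := by
  subst hx
  exact TB_zero_bv Q q n m hm b b' h0 h

lemma TB_succ_bv' (Q q : k) (n m i i' : ℕ) (hi : i' < m) (hi' : i + 1 = i') (x y : Fin n)
    (b b' : Fin m → Fin n)
    (hx : b ⟨i, by omega⟩ = x) (hy : b ⟨i', hi⟩ = y)
    (h0 : b' ⟨i, by omega⟩ = y) (h0' : b' ⟨i', hi⟩ = x)
    (h : ∀ j, j ≠ ⟨i, by omega⟩ → j ≠ ⟨i', hi⟩ → b' j = b j) :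
    TB Q q n m i' (bv b) = al q n x y • bv b + be k n x y • bv b' := by
  subst hi'
  subst hx
  subst hy
  exact TB_succ_bv Q q n m i hi b b' h0 h0' h

lemma end_ext {n m : ℕ} {f g : Module.End k ((Fin m → Fin n) → k)}
    (h : ∀ b, f (bv b) = g (bv b)) : f = g := by
  apply LinearMap.pi_ext'
  intro b
  apply LinearMap.ext_ring
  exact h b

lemma far_T {N : Type*} [AddCommGroup N] [Module k N] (A B : Module.End k N) {n : ℕ} (q : k)
    (D : Fin n → Fin n → Fin n → Fin n → N)
    (hA : ∀ x y z w, A (D x y z w) = al q n x y • D x y z w + be k n x y • D y x z w)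
    (hB : ∀ x y z w, B (D x y z w) = al q n z w • D x y z w + be k n z w • D x y w z) (x y z w) :
    (A * B) (D x y z w) = (B * A) (D x y z w) := by
  simp only [Module.End.mul_apply, hA, hB, map_add, map_smul]
  module

lemma far_0 {N : Type*} [AddCommGroup N] [Module k N] (A B : Module.End k N) {n : ℕ} (Q q : k)
    (D : Fin n → Fin n → Fin n → N)
    (hA : ∀ x y z, A (D x y z) = al0 Q n x • D x y z + be0 k n x • D (Fin.rev x) y z)
    (hB : ∀ x y z, B (D x y z) = al q n y z • D x y z + be k n y z • D x z y) (x y z) :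
    (A * B) (D x y z) = (B * A) (D x y z) := by
  simp only [Module.End.mul_apply, hA, hB, map_add, map_smul]
  module

lemma al_lt {q : k} {n : ℕ} {x y : Fin n} (h : val n x < val n y) : al q n x y = 0 := by
  simp [al, h, h.ne]
lemma al_gt {q : k} {n : ℕ} {x y : Fin n} (h : val n y < val n x) : al q n x y = q⁻¹ - q := by
  simp [al, h.not_gt, h.ne']
lemma al_eq {q : k} {n : ℕ} {x y : Fin n} (h : val n x = val n y) : al q n x y = q⁻¹ := by
  simp [al, h]
lemma be_eq {n : ℕ} {x y : Fin n} (h : val n x = val n y) : be k n x y = 0 := by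
  simp [be, h]
lemma be_ne {n : ℕ} {x y : Fin n} (h : val n x ≠ val n y) : be k n x y = 1 := by
  simp [be, h]
lemma al0_lt {q : k} {n : ℕ} {x : Fin n} (h : val n x < 0) : al0 q n x = q⁻¹ - q := by
  simp [al0, h, h.ne]
lemma al0_gt {q : k} {n : ℕ} {x : Fin n} (h : 0 < val n x) : al0 q n x = 0 := by
  simp [al0, h.not_gt, h.ne']
lemma al0_eq {q : k} {n : ℕ} {x : Fin n} (h : val n x = 0) : al0 q n x = q⁻¹ := by
  simp [al0, h]
lemma be0_eq {n : ℕ} {x : Fin n} (h : val n x = 0) : be0 k n x = 0 := by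
  simp [be0, h]
lemma be0_ne {n : ℕ} {x : Fin n} (h : val n x ≠ 0) : be0 k n x = 1 := by
  simp [be0, h]

lemma br_T {N : Type*} [AddCommGroup N] [Module k N] (A B : Module.End k N) {n : ℕ} (q : k)
    (hq : q ≠ 0) (D : Fin n → Fin n → Fin n → N)
    (hA : ∀ x y z, A (D x y z) = al q n x y • D x y z + be k n x y • D y x z)
    (hB : ∀ x y z, B (D x y z) = al q n y z • D x y z + be k n y z • D x z y) (x y z) :
    (A * B * A) (D x y z) = (B * A * B) (D x y z) := by
  simp only [Module.End.mul_apply, hA, hB, map_add, map_smul]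
  rcases lt_trichotomy (val n x) (val n y) with h1 | h1 | h1 <;>
  rcases lt_trichotomy (val n y) (val n z) with h2 | h2 | h2 <;>
  rcases lt_trichotomy (val n x) (val n z) with h3 | h3 | h3 <;>
  first
  | omega
  | (try simp only [val_inj] at h1
     try simp only [val_inj] at h2
     try simp only [val_inj] at h3
     try subst h1
     try subst h2
     try subst h3
     simp (disch := omega) only [al_lt, al_gt, al_eq, be_ne, be_eq, zero_smul, one_smul, zero_add,
       add_zero, smul_zero]
     try (match_scalars <;> field_simp <;> ring))

lemma br_B {N : Type*} [AddCommGroup N] [Module k N] (A B : Module.End k N) {n : ℕ} (Q q : k)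
    (hQ : Q ≠ 0) (hq : q ≠ 0) (D : Fin n → Fin n → N)
    (hA : ∀ x y, A (D x y) = al0 Q n x • D x y + be0 k n x • D (Fin.rev x) y)
    (hB : ∀ x y, B (D x y) = al q n x y • D x y + be k n x y • D y x) (x y) :
    (A * B * A * B) (D x y) = (B * A * B * A) (D x y) := by
  simp only [Module.End.mul_apply, hA, hB, map_add, map_smul, Fin.rev_rev]
  have rx := val_rev x
  have ry := val_rev y
  rcases lt_trichotomy (val n x) 0 with h1 | h1 | h1 <;>
  rcases lt_trichotomy (val n y) 0 with h2 | h2 | h2 <;>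
  rcases lt_trichotomy (val n x) (val n y) with h3 | h3 | h3 <;>
  rcases lt_trichotomy (val n x) (val n (Fin.rev y)) with h4 | h4 | h4 <;>
  first
  | omega
  | (try have e1 : Fin.rev x = x := val_inj.1 (by omega)
     try have e2 : Fin.rev y = y := val_inj.1 (by omega)
     try simp only [e1]
     try simp only [e2]
     try (have e3 := val_inj.1 h3; subst e3)
     try (have e4 := val_inj.1 h4; subst e4)
     simp (disch := omega) only [al_lt, al_gt, al_eq, be_ne, be_eq, al0_lt, al0_gt, al0_eq, be0_eq,
       be0_ne, zero_smul, one_smul, zero_add, add_zero, smul_zero, Fin.rev_rev]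
     try (match_scalars <;> field_simp <;> ring))

lemma far_end (Q q : k) (n : ℕ) : TB Q q n 4 1 * TB Q q n 4 3 = TB Q q n 4 3 * TB Q q n 4 1 := by
  apply end_ext
  intro b
  have := far_T (TB Q q n 4 1) (TB Q q n 4 3) q (fun x y z w => bv ![x, y, z, w])
    (fun x y z w => TB_succ_bv' Q q n 4 0 1 (by omega) rfl x y ![x, y, z, w] ![y, x, z, w] rfl rfl rfl rfl
      (fun j h1 h2 => by fin_cases j <;> first | rfl | simp at h1 h2))
    (fun x y z w => TB_succ_bv' Q q n 4 2 3 (by omega) rfl z w ![x, y, z, w] ![x, y, w, z] rfl rfl rfl rfl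
      (fun j h1 h2 => by fin_cases j <;> first | rfl | simp at h1 h2))
    (b 0) (b 1) (b 2) (b 3)
  have hb : ![b 0, b 1, b 2, b 3] = b := by
    funext j; fin_cases j <;> rfl
  simpa only [hb] using this

lemma far0_end (Q q : k) (n : ℕ) : TB Q q n 3 0 * TB Q q n 3 2 = TB Q q n 3 2 * TB Q q n 3 0 := by
  apply end_ext
  intro b
  have := far_0 (TB Q q n 3 0) (TB Q q n 3 2) Q q (fun x y z => bv ![x, y, z])
    (fun x y z => TB_zero_bv' Q q n 3 (by omega) x ![x, y, z] ![Fin.rev x, y, z] rfl rfl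
      (fun j h1 => by fin_cases j <;> first | rfl | simp at h1))
    (fun x y z => TB_succ_bv' Q q n 3 1 2 (by omega) rfl y z ![x, y, z] ![x, z, y] rfl rfl rfl rfl
      (fun j h1 h2 => by fin_cases j <;> first | rfl | simp at h1 h2))
    (b 0) (b 1) (b 2)
  have hb : ![b 0, b 1, b 2] = b := by
    funext j; fin_cases j <;> rfl
  simpa only [hb] using this

lemma br_end (Q q : k) (hq : q ≠ 0) (n : ℕ) : TB Q q n 3 1 * TB Q q n 3 2 * TB Q q n 3 1 =
    TB Q q n 3 2 * TB Q q n 3 1 * TB Q q n 3 2 := by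
  apply end_ext
  intro b
  have := br_T (TB Q q n 3 1) (TB Q q n 3 2) q hq (fun x y z => bv ![x, y, z])
    (fun x y z => TB_succ_bv' Q q n 3 0 1 (by omega) rfl x y ![x, y, z] ![y, x, z] rfl rfl rfl rfl
      (fun j h1 h2 => by fin_cases j <;> first | rfl | simp at h1 h2))
    (fun x y z => TB_succ_bv' Q q n 3 1 2 (by omega) rfl y z ![x, y, z] ![x, z, y] rfl rfl rfl rfl
      (fun j h1 h2 => by fin_cases j <;> first | rfl | simp at h1 h2))
    (b 0) (b 1) (b 2)
  have hb : ![b 0, b 1, b 2] = b := by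
    funext j; fin_cases j <;> rfl
  simpa only [hb] using this

lemma bb_end (Q q : k) (hQ : Q ≠ 0) (hq : q ≠ 0) (n : ℕ) :
    TB Q q n 2 0 * TB Q q n 2 1 * TB Q q n 2 0 * TB Q q n 2 1 =
    TB Q q n 2 1 * TB Q q n 2 0 * TB Q q n 2 1 * TB Q q n 2 0 := by
  apply end_ext
  intro b
  have := br_B (TB Q q n 2 0) (TB Q q n 2 1) Q q hQ hq (fun x y => bv ![x, y])
    (fun x y => TB_zero_bv' Q q n 2 (by omega) x ![x, y] ![Fin.rev x, y] rfl rfl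
      (fun j h1 => by fin_cases j <;> first | rfl | simp at h1))
    (fun x y => TB_succ_bv' Q q n 2 0 1 (by omega) rfl x y ![x, y] ![y, x] rfl rfl rfl rfl
      (fun j h1 h2 => by fin_cases j <;> first | rfl | simp at h1 h2))
    (b 0) (b 1)
  have hb : ![b 0, b 1] = b := by
    funext j; fin_cases j <;> rfl
  simpa only [hb] using this

/-- two adjacent pairs -/
def fourI {m : ℕ} (i j : ℕ) (hi : i + 2 ≤ j) (hj : j + 1 < m) (l : Fin 4) : Fin m :=
  if (l : ℕ) < 2 then ⟨i + l, by omega⟩ else ⟨j + l - 2, by omega⟩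

lemma fourI_inj {m : ℕ} (i j : ℕ) (hi : i + 2 ≤ j) (hj : j + 1 < m) :
    Function.Injective (fourI i j hi hj) := by
  intro a b hab
  unfold fourI at hab
  apply Fin.ext
  split_ifs at hab <;> simp only [Fin.mk.injEq] at hab <;> omega

/-- first position and an adjacent pair -/
def threeI {m : ℕ} (j : ℕ) (hi : 1 ≤ j) (hj : j + 1 < m) (l : Fin 3) : Fin m :=
  if (l : ℕ) < 1 then ⟨0, by omega⟩ else ⟨j + l - 1, by omega⟩

lemma threeI_inj {m : ℕ} (j : ℕ) (hi : 1 ≤ j) (hj : j + 1 < m) :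
    Function.Injective (threeI j hi hj) := by
  intro a b hab
  unfold threeI at hab
  apply Fin.ext
  split_ifs at hab <;> simp only [Fin.mk.injEq] at hab <;> omega

/-- three adjacent positions -/
def tripI {m : ℕ} (i : ℕ) (hi : i + 2 < m) (l : Fin 3) : Fin m := ⟨i + l, by omega⟩

lemma tripI_inj {m : ℕ} (i : ℕ) (hi : i + 2 < m) : Function.Injective (tripI i hi) := by
  intro a b hab
  simp only [tripI, Fin.mk.injEq] at hab
  exact Fin.ext (by omega)

lemma TB_braid (Q q : k) (hQ : Q ≠ 0) (hq : q ≠ 0) (n m : ℕ) : IsBraidB (TB Q q n m) where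
  far i j hij := by
    by_cases hj : j < m
    · obtain ⟨j, rfl⟩ : ∃ j', j = j' + 1 := ⟨j - 1, by omega⟩
      cases i with
      | zero =>
        have h := congrArg (ext (threeI j (by omega) hj)) (far0_end Q q n)
        have hι := threeI_inj j (by omega) hj
        rwa [ext_mul hι, ext_mul hι, ext_TB_zero Q q n 3 m (by omega) (by omega) _ hι rfl,
          ext_TB_succ Q q n 3 m 1 j (by omega) hj _ hι rfl rfl] at h
      | succ i =>
        have h := congrArg (ext (fourI i j (by omega) hj)) (far_end Q q n)
        have hι := fourI_inj i j (by omega) hj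
        rwa [ext_mul hι, ext_mul hι, ext_TB_succ Q q n 4 m 0 i (by omega) (by omega) _ hι rfl rfl,
          ext_TB_succ Q q n 4 m 2 j (by omega) hj _ hι rfl rfl] at h
    · rw [TB_big Q q n m j (by omega)]; exact Commute.zero_right _
  br i hi := by
    by_cases hj : i + 1 < m
    · obtain ⟨i, rfl⟩ : ∃ j', i = j' + 1 := ⟨i - 1, by omega⟩
      have h := congrArg (ext (tripI i hj)) (br_end Q q hq n)
      have hι := tripI_inj i hj
      rwa [ext_mul hι, ext_mul hι, ext_mul hι, ext_mul hι,
        ext_TB_succ Q q n 3 m 0 i (by omega) (by omega) _ hι rfl rfl,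
        ext_TB_succ Q q n 3 m 1 (i + 1) (by omega) (by omega) _ hι rfl rfl] at h
    · rw [TB_big Q q n m (i + 1) (by omega)]; simp
  bb := by
    by_cases hj : 1 < m
    · have h := congrArg (ext (pairI 0 hj)) (bb_end Q q hQ hq n)
      have hι := pairI_inj 0 hj
      rwa [ext_mul hι, ext_mul hι, ext_mul hι, ext_mul hι, ext_mul hι, ext_mul hι,
        ext_TB_zero Q q n 2 m (by omega) (by omega) _ hι rfl,
        ext_TB_succ Q q n 2 m 0 0 (by omega) (by omega) _ hι rfl rfl] at h
    · rw [TB_big Q q n m 1 (by omega)]; simp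

end braidPart

section finalPart

lemma JM_eq (Q q : k) (n m : ℕ) : ∀ i, JM Q q n m i = aJ (TB Q q n m) i
  | 0 => rfl
  | 1 => rfl
  | i + 2 => by simp only [JM, aJ, JM_eq Q q n m (i + 1)]

lemma prod_eq (Q q : k) (n m : ℕ) : ∀ d,
    ((List.range d).map (fun i => JM Q q n m (i + 1))).prod = aP (TB Q q n m) 0 d
  | 0 => rfl
  | d + 1 => by
    rw [List.range_succ, List.map_append, List.prod_append, prod_eq Q q n m d]
    simp [aP, JM_eq]

lemma cK_eq (Q q : k) (n d : ℕ) : cK Q q n d = aP (TB Q q n d) 0 d := prod_eq Q q n d d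

lemma cast_aJ (Q q : k) (n s m : ℕ) (h : s ≤ m) : ∀ i, i ≤ s →
    ext (Fin.castLE h) (aJ (TB Q q n s) i) = aJ (TB Q q n m) i
  | 0, _ => ext_one (Fin.castLE_injective h)
  | 1, hi => castLE_TB Q q n s m 0 h (by omega)
  | i + 2, hi => by
    simp only [aJ, ext_mul (Fin.castLE_injective h), cast_aJ Q q n s m h (i + 1) (by omega),
      castLE_TB Q q n s m (i + 1) h (by omega)]

lemma cast_aP (Q q : k) (n s m : ℕ) (h : s ≤ m) : ∀ d, d ≤ s →
    ext (Fin.castLE h) (aP (TB Q q n s) 0 d) = aP (TB Q q n m) 0 d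
  | 0, _ => ext_one (Fin.castLE_injective h)
  | d + 1, hi => by
    simp only [aP, ext_mul (Fin.castLE_injective h), cast_aP Q q n s m h d (by omega),
      cast_aJ Q q n s m h (0 + d + 1) (by omega)]

lemma extFirst_cK (Q q : k) (n s m : ℕ) (h : s ≤ m) :
    extFirst s m h n (cK Q q n s) = aP (TB Q q n m) 0 s := by
  rw [extFirst_eq, cK_eq, cast_aP _ _ _ _ _ _ _ le_rfl]

lemma cast_aRow (Q q : k) (n s m : ℕ) (h : s ≤ m) (o : ℕ) : ∀ d, o + d < s →
    ext (Fin.castLE h) (aRow (TB Q q n s) o d) = aRow (TB Q q n m) o d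
  | 0, _ => ext_one (Fin.castLE_injective h)
  | d + 1, hi => by
    simp only [aRow, ext_mul (Fin.castLE_injective h), cast_aRow Q q n s m h o d (by omega),
      castLE_TB Q q n s m (o + d + 1) h (by omega)]

lemma cast_aCol (Q q : k) (n s m : ℕ) (h : s ≤ m) (o : ℕ) : ∀ d, o + d < s →
    ext (Fin.castLE h) (aCol (TB Q q n s) o d) = aCol (TB Q q n m) o d
  | 0, _ => ext_one (Fin.castLE_injective h)
  | d + 1, hi => by
    simp only [aCol, ext_mul (Fin.castLE_injective h), cast_aCol Q q n s m h o d (by omega),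
      castLE_TB Q q n s m (o + d + 1) h (by omega)]

lemma last_aRow (Q q : k) (n s m : ℕ) (h : s ≤ m) : ∀ d, d < s →
    ext (lastI h) (aRow (TB Q q n s) 0 d) = aRow (TB Q q n m) (m - s) d
  | 0, _ => ext_one (lastI_inj h)
  | d + 1, hi => by
    simp only [aRow, ext_mul (lastI_inj h), last_aRow Q q n s m h d (by omega),
      Nat.zero_add,
      lastI_TB Q q n s m d h (by omega)]

lemma last_aCol (Q q : k) (n s m : ℕ) (h : s ≤ m) : ∀ d, d < s →
    ext (lastI h) (aCol (TB Q q n s) 0 d) = aCol (TB Q q n m) (m - s) d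
  | 0, _ => ext_one (lastI_inj h)
  | d + 1, hi => by
    simp only [aCol, ext_mul (lastI_inj h), last_aCol Q q n s m h d (by omega),
      Nat.zero_add,
      lastI_TB Q q n s m d h (by omega)]

lemma cast_aX (Q q : k) (n s m : ℕ) (h : s ≤ m) (e : ℕ) : ∀ d, e + d ≤ s →
    ext (Fin.castLE h) (aX (TB Q q n s) e d) = aX (TB Q q n m) e d
  | 0, _ => ext_one (Fin.castLE_injective h)
  | d + 1, hi => by
    simp only [aX, ext_mul (Fin.castLE_injective h), cast_aX Q q n s m h e d (by omega),
      cast_aRow Q q n s m h d e (by omega)]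

lemma cast_aY (Q q : k) (n s m : ℕ) (h : s ≤ m) (e : ℕ) : ∀ d, e + d ≤ s →
    ext (Fin.castLE h) (aY (TB Q q n s) e d) = aY (TB Q q n m) e d
  | 0, _ => ext_one (Fin.castLE_injective h)
  | d + 1, hi => by
    simp only [aY, ext_mul (Fin.castLE_injective h), cast_aY Q q n s m h e d (by omega),
      cast_aCol Q q n s m h d e (by omega)]

lemma R2op_eq (Q q : k) (n : ℕ) : R2op q n = TB Q q n 2 1 := by
  rw [TB_succ Q q n 2 0 (by omega)]
  have h := ext_one (k := k) (n := n) (pairI_inj (m := 2) 0 (by omega))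
  have hid : pairI (m := 2) 0 (by omega) = id := by
    funext j; apply Fin.ext; simp [pairI]
  rw [hid]
  apply LinearMap.ext; intro v; funext c
  rw [ext_apply]
  have : ∀ a : Fin 2 → Fin n, Function.extend id a c = a := by
    intro a; funext j; exact Function.injective_id.extend_apply a c j
  simp only [this, id]

lemma Rfam_row (Q q : k) (n : ℕ)
    (Rfam : ∀ (_a _b mm : ℕ), Module.End k ((Fin mm → Fin n) → k))
    (hbase : Rfam 1 1 2 = R2op q n)
    (hsplit₁ : ∀ a₁ a₂ b : ℕ, 0 < a₁ → 0 < a₂ → 0 < b →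
      Rfam (a₁ + a₂) b (a₁ + a₂ + b) =
        extFirst (a₁ + b) (a₁ + a₂ + b) (by omega) n (Rfam a₁ b (a₁ + b)) *
          extLast (a₂ + b) (a₁ + a₂ + b) (by omega) n (Rfam a₂ b (a₂ + b))) :
    ∀ a, Rfam (a + 1) 1 (a + 1 + 1) = aRow (TB Q q n (a + 1 + 1)) 0 (a + 1)
  | 0 => by
    rw [hbase, R2op_eq Q]
    simp [aRow]
  | a + 1 => by
    rw [hsplit₁ (a + 1) 1 1 (by omega) (by omega) (by omega), extFirst_eq, extLast_eq,
      Rfam_row Q q n Rfam hbase hsplit₁ a, hbase, R2op_eq Q, cast_aRow _ _ _ _ _ _ _ _ (by omega),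
      lastI_TB Q q n (1 + 1) _ 0 _ (by omega)]
    rw [aRow.eq_def _ _ (a + 1 + 1)]
    congr 2
    omega

lemma Rfam_col (Q q : k) (n : ℕ)
    (Rfam : ∀ (_a _b mm : ℕ), Module.End k ((Fin mm → Fin n) → k))
    (hbase : Rfam 1 1 2 = R2op q n)
    (hsplit₂ : ∀ a b₁ b₂ : ℕ, 0 < a → 0 < b₁ → 0 < b₂ →
      Rfam a (b₁ + b₂) (a + b₁ + b₂) =
        extLast (a + b₂) (a + b₁ + b₂) (by omega) n (Rfam a b₂ (a + b₂)) *
          extFirst (a + b₁) (a + b₁ + b₂) (by omega) n (Rfam a b₁ (a + b₁))) :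
    ∀ b m, m = 1 + (b + 1) → Rfam 1 (b + 1) m = aCol (TB Q q n m) 0 (b + 1)
  | 0, m, hm => by
    subst hm
    change Rfam 1 1 2 = aCol (TB Q q n 2) 0 1
    rw [hbase, R2op_eq Q]
    simp [aCol]
  | b + 1, m, hm => by
    subst hm
    have h := hsplit₂ 1 (b + 1) 1 (by omega) (by omega) (by omega)
    rw [extFirst_eq, extLast_eq,
      Rfam_col Q q n Rfam hbase hsplit₂ b _ rfl, hbase, R2op_eq Q,
      cast_aCol _ _ _ _ _ _ _ _ (by omega),
      lastI_TB Q q n (1 + 1) _ 0 _ (by omega)] at h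
    refine h.trans ?_
    rw [aCol.eq_def _ _ (b + 1 + 1)]
    congr 2
    omega

lemma Rfam_X (Q q : k) (n : ℕ)
    (Rfam : ∀ (_a _b mm : ℕ), Module.End k ((Fin mm → Fin n) → k))
    (hbase : Rfam 1 1 2 = R2op q n)
    (hsplit₁ : ∀ a₁ a₂ b : ℕ, 0 < a₁ → 0 < a₂ → 0 < b →
      Rfam (a₁ + a₂) b (a₁ + a₂ + b) =
        extFirst (a₁ + b) (a₁ + a₂ + b) (by omega) n (Rfam a₁ b (a₁ + b)) *
          extLast (a₂ + b) (a₁ + a₂ + b) (by omega) n (Rfam a₂ b (a₂ + b)))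
    (hsplit₂ : ∀ a b₁ b₂ : ℕ, 0 < a → 0 < b₁ → 0 < b₂ →
      Rfam a (b₁ + b₂) (a + b₁ + b₂) =
        extLast (a + b₂) (a + b₁ + b₂) (by omega) n (Rfam a b₂ (a + b₂)) *
          extFirst (a + b₁) (a + b₁ + b₂) (by omega) n (Rfam a b₁ (a + b₁))) (e : ℕ) :
    ∀ d m, m = (e + 1) + (d + 1) → Rfam (e + 1) (d + 1) m = aX (TB Q q n m) (e + 1) (d + 1)
  | 0, m, hm => by
    subst hm
    refine (Rfam_row Q q n Rfam hbase hsplit₁ e).trans ?_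
    simp [aX]
  | d + 1, m, hm => by
    subst hm
    have h := hsplit₂ (e + 1) (d + 1) 1 (by omega) (by omega) (by omega)
    rw [extFirst_eq, extLast_eq,
      Rfam_X Q q n Rfam hbase hsplit₁ hsplit₂ e d _ rfl, Rfam_row Q q n Rfam hbase hsplit₁ e,
      cast_aX _ _ _ _ _ _ _ _ (by omega), last_aRow _ _ _ _ _ _ _ (by omega)] at h
    refine h.trans ?_
    rw [aX.eq_def _ _ (d + 1 + 1)]
    have : e + 1 + (d + 1) + 1 - (e + 1 + 1) = d + 1 := by omega
    rw [this]
    rfl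

lemma Rfam_Y (Q q : k) (n : ℕ)
    (Rfam : ∀ (_a _b mm : ℕ), Module.End k ((Fin mm → Fin n) → k))
    (hbase : Rfam 1 1 2 = R2op q n)
    (hsplit₁ : ∀ a₁ a₂ b : ℕ, 0 < a₁ → 0 < a₂ → 0 < b →
      Rfam (a₁ + a₂) b (a₁ + a₂ + b) =
        extFirst (a₁ + b) (a₁ + a₂ + b) (by omega) n (Rfam a₁ b (a₁ + b)) *
          extLast (a₂ + b) (a₁ + a₂ + b) (by omega) n (Rfam a₂ b (a₂ + b)))
    (hsplit₂ : ∀ a b₁ b₂ : ℕ, 0 < a → 0 < b₁ → 0 < b₂ →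
      Rfam a (b₁ + b₂) (a + b₁ + b₂) =
        extLast (a + b₂) (a + b₁ + b₂) (by omega) n (Rfam a b₂ (a + b₂)) *
          extFirst (a + b₁) (a + b₁ + b₂) (by omega) n (Rfam a b₁ (a + b₁))) (e : ℕ) :
    ∀ d m, m = (d + 1) + (e + 1) → Rfam (d + 1) (e + 1) m = aY (TB Q q n m) (e + 1) (d + 1)
  | 0, m, hm => by
    refine (Rfam_col Q q n Rfam hbase hsplit₂ e m (by omega)).trans ?_
    simp [aY]
  | d + 1, m, hm => by
    subst hm
    rw [hsplit₁ (d + 1) 1 (e + 1) (by omega) (by omega) (by omega), extFirst_eq, extLast_eq,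
      Rfam_Y Q q n Rfam hbase hsplit₁ hsplit₂ e d _ rfl,
      Rfam_col Q q n Rfam hbase hsplit₂ e _ rfl,
      cast_aY _ _ _ _ _ _ _ _ (by omega), last_aCol _ _ _ _ _ _ _ (by omega)]
    have : d + 1 + 1 + (e + 1) - (1 + (e + 1)) = d + 1 := by omega
    rw [this]
    rfl

end finalPart

/-- The cylinder-twist identity.  Let `Ř` be the family of
iterated `R`-matrices `Ř_{a,b} : V_n^{⊗a} ⊗ V_n^{⊗b} → V_n^{⊗b} ⊗ V_n^{⊗a}`
(viewed as endomorphisms of `V_n^{⊗(a+b)}`; the third argument of `Rfam` is the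
total number `a + b` of tensor factors), determined by `Ř_{1,1} = R_q` and the
two splitting rules.  Then for all `d, e ≥ 1`:
`C_{d+e} = (C_d ⊗ Id) ∘ Ř_{e,d} ∘ (C_e ⊗ Id) ∘ Ř_{d,e}
         = Ř_{e,d} ∘ (C_e ⊗ Id) ∘ Ř_{d,e} ∘ (C_d ⊗ Id)`,
where `C_m = K_1 ⋯ K_m` on `V_n^{⊗m}` and multiplication of endomorphisms is
composition. -/
theorem cylinder_twist_identity
    (Q q : k) (hQ : Q ≠ 0) (hq : q ≠ 0) (n : ℕ) (hn : 1 ≤ n)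
    (Rfam : ∀ (_a _b mm : ℕ), Module.End k ((Fin mm → Fin n) → k))
    (hbase : Rfam 1 1 2 = R2op q n)
    (hsplit₁ : ∀ a₁ a₂ b : ℕ, 0 < a₁ → 0 < a₂ → 0 < b →
      Rfam (a₁ + a₂) b (a₁ + a₂ + b) =
        extFirst (a₁ + b) (a₁ + a₂ + b) (by omega) n (Rfam a₁ b (a₁ + b)) *
          extLast (a₂ + b) (a₁ + a₂ + b) (by omega) n (Rfam a₂ b (a₂ + b)))
    (hsplit₂ : ∀ a b₁ b₂ : ℕ, 0 < a → 0 < b₁ → 0 < b₂ →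
      Rfam a (b₁ + b₂) (a + b₁ + b₂) =
        extLast (a + b₂) (a + b₁ + b₂) (by omega) n (Rfam a b₂ (a + b₂)) *
          extFirst (a + b₁) (a + b₁ + b₂) (by omega) n (Rfam a b₁ (a + b₁)))
    (d e : ℕ) (hd : 0 < d) (he : 0 < e) :
    cK Q q n (d + e) =
      extFirst d (d + e) (by omega) n (cK Q q n d) * Rfam e d (d + e) *
        extFirst e (d + e) (by omega) n (cK Q q n e) * Rfam d e (d + e) ∧
    cK Q q n (d + e) =
      Rfam e d (d + e) * extFirst e (d + e) (by omega) n (cK Q q n e) *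
        Rfam d e (d + e) * extFirst d (d + e) (by omega) n (cK Q q n d) := by
  obtain ⟨d, rfl⟩ : ∃ d1, d = d1 + 1 := ⟨d - 1, by omega⟩
  obtain ⟨e, rfl⟩ : ∃ e1, e = e1 + 1 := ⟨e - 1, by omega⟩
  have hB := TB_braid Q q hQ hq n (d + 1 + (e + 1))
  have hXY := aX_aY hB (e + 1) (d + 1)
  have hc := aP_comm hB (d + 1) (e + 1)
  rw [cK_eq, extFirst_cK, extFirst_cK, aP_add,
    Rfam_X Q q n Rfam hbase hsplit₁ hsplit₂ e d _ (by omega),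
    Rfam_Y Q q n Rfam hbase hsplit₁ hsplit₂ e d _ rfl, hXY, ← hc.eq]
  refine ⟨?_, rfl⟩
  rw [← hXY]
  simp only [mul_assoc]

end QSP
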